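/- arXiv:1611.10275 — 2 statements merged into one kernel-verified Lean document; each statement's English description precedes it below -/
import Mathlib

section
/- For each exponent p with 2 ≤ p ≤ 6 there is a constant C_p, depending only on p, such that for every R > 0 and every smooth function f : ℝ → ℂ supported in [-1,1], one has ‖Ef‖_{L^p(B_R)} ≤ C_p · R^{3/(2p) - 1/4} · ‖f‖_{L²}. -/
open MeasureTheory Real Set ENNReal

noncomputable section

/-- The extension operator: `Ef(x,t) = ∫_{[-1,1]} e^{i(ω²t + ωx)} f(ω) dω`,
viewed as a function on `ℝ × ℝ` with `z = (x, t)`. -/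
def extOp (f : ℝ → ℂ) : ℝ × ℝ → ℂ := fun z =>
  ∫ ω in Icc (-1 : ℝ) 1, Complex.exp (Complex.I * ((ω ^ 2 * z.2 + ω * z.1 : ℝ) : ℂ)) * f ω

/-- The `L²` norm of a function on `ℝ`. -/
def L2norm (f : ℝ → ℂ) : ℝ := (eLpNorm f 2 volume).toReal

/-- The `Lᵖ` norm over the ball of radius `R` centered at the origin of `ℝ²`. -/
def LpBall (g : ℝ × ℝ → ℂ) (p R : ℝ) : ℝ≥0∞ :=
  eLpNorm g (ENNReal.ofReal p) (volume.restrict (Metric.ball (0 : ℝ × ℝ) R))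

open scoped FourierTransform RealInnerProductSpace in
lemma eLpNorm_fourier_eq {V : Type*} [NormedAddCommGroup V] [InnerProductSpace ℝ V]
    [FiniteDimensional ℝ V] [MeasurableSpace V] [BorelSpace V] {g : V → ℂ}
    (h1 : Integrable g) (h2 : MemLp g 2) :
    eLpNorm (𝓕 g) 2 volume = eLpNorm g 2 volume := by
  have hcont : Continuous (𝓕 g) := VectorFourier.fourierIntegral_continuous
    Real.continuous_fourierChar (L := innerₗ V) (μ := volume) continuous_inner h1
  have key : 𝓕 g =ᵐ[volume] (𝓕 (h2.toLp g) : Lp ℂ 2 (volume : Measure V)) := by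
    refine ae_eq_of_integral_contDiff_smul_eq hcont.locallyIntegrable
      ((Lp.memLp _).locallyIntegrable (by norm_num)) fun φ hφ hφc ↦ ?_
    have hφ' : ContDiff ℝ (⊤ : ℕ∞) (fun x ↦ (φ x : ℂ)) := Complex.ofRealCLM.contDiff.comp hφ
    have hφc' : HasCompactSupport (fun x ↦ (φ x : ℂ)) :=
      hφc.comp_left (g := ((↑) : ℝ → ℂ)) Complex.ofReal_zero
    let ψ : SchwartzMap V ℂ := hφc'.toSchwartzMap hφ'
    have hψ : ∀ x, ψ x = (φ x : ℂ) := fun x ↦ rfl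
    have e1 := DFunLike.congr_fun (Lp.fourier_toTemperedDistribution_eq (h2.toLp g)) ψ
    rw [TemperedDistribution.fourier_apply, Lp.toTemperedDistribution_apply,
      Lp.toTemperedDistribution_apply] at e1
    have e2 : ∫ x, (𝓕 ψ) x • (h2.toLp g) x = ∫ x, (𝓕 ψ) x • g x := by
      refine integral_congr_ae ?_
      filter_upwards [h2.coeFn_toLp] with x hx
      rw [hx]
    have e3 := VectorFourier.integral_fourierIntegral_smul_eq_flip (L := innerₗ V)
      Real.continuous_fourierChar continuous_inner (SchwartzMap.integrable (μ := volume) ψ) h1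
    have e4 : ∫ x, φ x • (𝓕 g) x = ∫ x, ψ x • VectorFourier.fourierIntegral Real.fourierChar volume
        (innerₗ V).flip g x := by
      rw [flip_innerₗ V]
      rfl
    rw [e4, ← e3]
    exact e2.symm.trans e1
  rw [eLpNorm_congr_ae key]
  have := congrArg ENNReal.ofReal (Lp.norm_fourier_eq (h2.toLp g))
  rw [Lp.norm_def, Lp.norm_def, ENNReal.ofReal_toReal (Lp.eLpNorm_ne_top _),
    ENNReal.ofReal_toReal (Lp.eLpNorm_ne_top _)] at this
  rw [this]
  exact eLpNorm_congr_ae h2.coeFn_toLp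

lemma exists_lintegral_comp_linearEquiv {E F : Type*} [NormedAddCommGroup E] [NormedSpace ℝ E]
    [NormedAddCommGroup F] [NormedSpace ℝ F] [MeasurableSpace E] [BorelSpace E]
    [MeasurableSpace F] [BorelSpace F] [FiniteDimensional ℝ F] (μ : Measure E) [μ.IsAddHaarMeasure]
    (ν : Measure F) [ν.IsAddHaarMeasure] (L : E ≃L[ℝ] F) :
    ∃ c : ℝ≥0∞, c ≠ ∞ ∧ ∀ φ : F → ℝ≥0∞, ∫⁻ x, φ (L x) ∂μ = c * ∫⁻ y, φ y ∂ν := by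
  have h := Measure.isAddLeftInvariant_eq_smul (μ.map L) ν
  refine ⟨((μ.map L).addHaarScalarFactor ν : ℝ≥0∞), ENNReal.coe_ne_top, fun φ ↦ ?_⟩
  rw [← smul_eq_mul, ← lintegral_smul_measure]
  change _ = ∫⁻ y, φ y ∂((μ.map L).addHaarScalarFactor ν • ν)
  rw [← h]
  exact (lintegral_map_equiv φ L.toHomeomorph.toMeasurableEquiv).symm

lemma sq_lintegral_mul_le {α : Type*} [MeasurableSpace α] {μ : Measure α} {f g : α → ℝ≥0∞}
    (hf : AEMeasurable f μ) (hg : AEMeasurable g μ) :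
    (∫⁻ a, f a * g a ∂μ) ^ 2 ≤ (∫⁻ a, f a ^ 2 ∂μ) * ∫⁻ a, g a ^ 2 ∂μ := by
  have h := ENNReal.lintegral_mul_norm_pow_le (hf.pow_const 2) (hg.pow_const 2)
    (p := 1 / 2) (q := 1 / 2) (by norm_num) (by norm_num) (by norm_num)
  have key (x : ℝ≥0∞) : (x ^ 2) ^ (1 / 2 : ℝ) = x := by
    rw [← ENNReal.rpow_natCast, ← ENNReal.rpow_mul]; norm_num
  have key' (x : ℝ≥0∞) : (x ^ (1 / 2 : ℝ)) ^ 2 = x := by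
    rw [← ENNReal.rpow_natCast, ← ENNReal.rpow_mul]; norm_num
  simp only [key] at h
  calc _ ≤ _ := pow_le_pow_left' h 2
    _ = _ := by rw [mul_pow, key', key']

open scoped RealInnerProductSpace in
lemma exists_lintegral_sq_exp_inner_le (V : Type*) [NormedAddCommGroup V] [InnerProductSpace ℝ V]
    [FiniteDimensional ℝ V] [MeasurableSpace V] [BorelSpace V] :
    ∃ C : ℝ≥0∞, C ≠ ∞ ∧ ∀ g : V → ℂ, Integrable g → MemLp g 2 →
      ∫⁻ w, ‖∫ v, Complex.exp (Complex.I * (⟪v, w⟫ : ℝ)) * g v‖ₑ ^ 2 ≤ C * ∫⁻ v, ‖g v‖ₑ ^ 2 := by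
  have hc : -(2 * π)⁻¹ ≠ 0 := by simp [Real.pi_ne_zero]
  obtain ⟨C, hC, h⟩ := exists_lintegral_comp_linearEquiv (volume : Measure V) (volume : Measure V)
    (ContinuousLinearEquiv.smulLeft (Units.mk0 _ hc))
  refine ⟨C, hC, fun g h1 h2 ↦ ?_⟩
  have e : ∀ w, ∫ v, Complex.exp (Complex.I * (⟪v, w⟫ : ℝ)) * g v =
      FourierTransform.fourier g ((ContinuousLinearEquiv.smulLeft (Units.mk0 _ hc) : V ≃L[ℝ] V) w) := by
    intro w
    rw [Real.fourier_eq']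
    refine integral_congr_ae (ae_of_all _ fun v ↦ ?_)
    simp [Units.smul_def, inner_smul_right]
    left
    congr 1
    field_simp
  simp only [e]
  rw [h (fun w ↦ ‖FourierTransform.fourier g w‖ₑ ^ 2)]
  have := eLpNorm_fourier_eq h1 h2
  simp only [eLpNorm_eq_lintegral_rpow_enorm_toReal two_ne_zero ENNReal.ofNat_ne_top,
    ENNReal.toReal_ofNat, ENNReal.rpow_ofNat] at this
  rw [ENNReal.rpow_left_injective (by norm_num : (1 / 2 : ℝ) ≠ 0) this]

lemma exists_lintegral_sq_exp_prod_le :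
    ∃ C : ℝ≥0∞, C ≠ ∞ ∧ ∀ g : ℝ × ℝ → ℂ, Integrable g → MemLp g 2 →
      ∫⁻ w : ℝ × ℝ, ‖∫ z, Complex.exp (Complex.I * ((w.2 * z.2 + w.1 * z.1 : ℝ) : ℂ)) * g z‖ₑ ^ 2 ≤
        C * ∫⁻ z, ‖g z‖ₑ ^ 2 := by
  obtain ⟨C, hC, h⟩ := exists_lintegral_sq_exp_inner_le (WithLp 2 (ℝ × ℝ))
  refine ⟨C, hC, fun g h1 h2 ↦ ?_⟩
  have hm := WithLp.volume_preserving_ofLp ℝ ℝ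
  have he : MeasurableEmbedding (@WithLp.ofLp 2 (ℝ × ℝ)) :=
    (MeasurableEquiv.toLp 2 (ℝ × ℝ)).symm.measurableEmbedding
  have := h (g ∘ WithLp.ofLp) (hm.integrable_comp_emb he |>.2 h1) (h2.comp_measurePreserving hm)
  have e (w : ℝ × ℝ) : ∫ z, Complex.exp (Complex.I * ((w.2 * z.2 + w.1 * z.1 : ℝ) : ℂ)) * g z =
      ∫ v : WithLp 2 (ℝ × ℝ), Complex.exp (Complex.I * (inner ℝ v (WithLp.toLp 2 w) : ℝ)) *
        (g ∘ WithLp.ofLp) v := by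
    rw [← hm.integral_comp he]
    simp [WithLp.prod_inner_apply, add_comm]
  simp only [e]
  rwa [← hm.lintegral_comp_emb he, ← hm.lintegral_comp_emb he]

lemma lintegral_radial_le (s : ℝ) {φ : ℝ → ℝ≥0∞} (hφ : Measurable φ) :
    ∫⁻ y : ℝ × ℝ, φ (s + 6 * (y.1 ^ 2 + y.2 ^ 2)) ≤ ENNReal.ofReal (2 * π) * ∫⁻ b, φ b := by
  have hinj : InjOn (fun r : ℝ ↦ s + 6 * r ^ 2) (Ioi 0) := by
    intro a ha b hb hab
    simp only [mem_Ioi] at ha hb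
    have : a ^ 2 = b ^ 2 := by simpa using hab
    nlinarith
  have hder : ∀ r ∈ Ioi (0 : ℝ), HasDerivWithinAt (fun r : ℝ ↦ s + 6 * r ^ 2) (12 * r) (Ioi 0) r := by
    intro r _
    have := (((hasDerivAt_id r).pow 2).const_mul 6).const_add s
    refine (this.congr_deriv ?_).hasDerivWithinAt
    simp; ring
  have hsub := lintegral_image_eq_lintegral_abs_deriv_mul measurableSet_Ioi hder hinj φ
  rw [← lintegral_comp_polarCoord_symm]
  have e : ∀ p : ℝ × ℝ, ENNReal.ofReal p.1 • φ (s + 6 * ((polarCoord.symm p).1 ^ 2 +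
      (polarCoord.symm p).2 ^ 2)) = (ENNReal.ofReal p.1 * φ (s + 6 * p.1 ^ 2)) * 1 := by
    intro p
    have : (p.1 * cos p.2) ^ 2 + (p.1 * sin p.2) ^ 2 = p.1 ^ 2 := by
      nlinarith [sin_sq_add_cos_sq p.2]
    simp [this]
  simp only [e]
  rw [polarCoord_target, Measure.volume_eq_prod, ← Measure.prod_restrict,
    lintegral_prod_mul (f := fun r ↦ ENNReal.ofReal r * φ (s + 6 * r ^ 2)) (g := fun _ ↦ 1)
      (by fun_prop) (by fun_prop)]
  simp only [lintegral_one, Measure.restrict_apply_univ, Real.volume_Ioo]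
  rw [mul_comm]
  refine mul_le_mul' (by ring_nf; rfl) ?_
  calc _ ≤ ∫⁻ r in Ioi 0, ENNReal.ofReal |12 * r| * φ (s + 6 * r ^ 2) := by
        refine setLIntegral_mono' measurableSet_Ioi fun r hr ↦ ?_
        gcongr
        rw [abs_of_pos (by simp at hr; positivity)]
        simp at hr; linarith
    _ ≤ _ := by
        rw [← hsub]
        exact setLIntegral_le_lintegral _ _

lemma exists_lintegral_comp_sum_le :
    ∃ C : ℝ≥0∞, C ≠ ∞ ∧ ∀ φ : ℝ × ℝ → ℝ≥0∞, Measurable φ →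
      ∫⁻ ω : ℝ × ℝ × ℝ, φ (ω.1 + ω.2.1 + ω.2.2, ω.1 ^ 2 + ω.2.1 ^ 2 + ω.2.2 ^ 2) ≤
        C * ∫⁻ z, φ z := by
  have h3' : √3 ≠ 0 := by positivity
  let L : (ℝ × ℝ × ℝ) ≃ₗ[ℝ] (ℝ × ℝ × ℝ) :=
    { toFun := fun ω ↦ (ω.1 + ω.2.1 + ω.2.2, (ω.1 - ω.2.1) / (2 * √3),
        (ω.1 + ω.2.1 - 2 * ω.2.2) / 6)
      invFun := fun u ↦ (u.1 / 3 + √3 * u.2.1 + u.2.2, u.1 / 3 - √3 * u.2.1 + u.2.2,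
        u.1 / 3 - 2 * u.2.2)
      map_add' := fun x y ↦ by
        ext <;> simp <;> ring
      map_smul' := fun c x ↦ by
        ext <;> simp <;> ring
      left_inv := fun ω ↦ by
        ext <;> simp <;> field_simp <;> ring
      right_inv := fun ω ↦ by
        ext <;> simp <;> field_simp <;> ring }
  have : (volume : Measure (ℝ × ℝ)).IsAddHaarMeasure :=
    Measure.prod.instIsAddHaarMeasure (volume : Measure ℝ) (volume : Measure ℝ)
  have : (volume : Measure (ℝ × ℝ × ℝ)).IsAddHaarMeasure :=
    Measure.prod.instIsAddHaarMeasure (volume : Measure ℝ) (volume : Measure (ℝ × ℝ))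
  obtain ⟨c, hc, h⟩ := exists_lintegral_comp_linearEquiv (volume : Measure (ℝ × ℝ × ℝ))
    (volume : Measure (ℝ × ℝ × ℝ)) L.toContinuousLinearEquiv
  refine ⟨c * ENNReal.ofReal (2 * π), ENNReal.mul_ne_top hc ENNReal.ofReal_ne_top,
    fun φ hφ ↦ ?_⟩
  have hL (ω : ℝ × ℝ × ℝ) : L.toContinuousLinearEquiv ω = (ω.1 + ω.2.1 + ω.2.2,
    (ω.1 - ω.2.1) / (2 * √3), (ω.1 + ω.2.1 - 2 * ω.2.2) / 6) := rfl
  have e (ω : ℝ × ℝ × ℝ) : φ (ω.1 + ω.2.1 + ω.2.2, ω.1 ^ 2 + ω.2.1 ^ 2 + ω.2.2 ^ 2) =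
      (fun u : ℝ × ℝ × ℝ ↦ φ (u.1, u.1 ^ 2 / 3 + 6 * (u.2.1 ^ 2 + u.2.2 ^ 2)))
        (L.toContinuousLinearEquiv ω) := by
    simp only [hL]
    congr 2
    rw [div_pow, mul_pow, Real.sq_sqrt (by norm_num)]
    ring
  simp only [e]
  rw [h (fun u : ℝ × ℝ × ℝ ↦ φ (u.1, u.1 ^ 2 / 3 + 6 * (u.2.1 ^ 2 + u.2.2 ^ 2))),
    mul_assoc]
  gcongr
  rw [Measure.volume_eq_prod ℝ (ℝ × ℝ), lintegral_prod _ (by fun_prop),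
    Measure.volume_eq_prod ℝ ℝ, lintegral_prod _ hφ.aemeasurable,
    ← lintegral_const_mul _ hφ.lintegral_prod_right']
  exact lintegral_mono fun s ↦ lintegral_radial_le (s ^ 2 / 3) (φ := fun b ↦ φ (s, b)) (by fun_prop)

lemma norm_exp_I_mul_ofReal (x : ℝ) : ‖Complex.exp (Complex.I * (x : ℂ))‖ = 1 := by
  rw [mul_comm, Complex.norm_exp_ofReal_mul_I]

section extOp

variable {f : ℝ → ℂ}

lemma extOp_eq_integral (hs : Function.support f ⊆ Icc (-1) 1) (z : ℝ × ℝ) :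
    extOp f z =
      ∫ ω, Complex.exp (Complex.I * ((ω ^ 2 * z.2 + ω * z.1 : ℝ) : ℂ)) * f ω := by
  refine setIntegral_eq_integral_of_forall_compl_eq_zero fun ω hω ↦ ?_
  rw [Function.notMem_support.1 fun h ↦ hω (hs h), mul_zero]

lemma hasCompactSupport_of_support_subset_Icc (hs : Function.support f ⊆ Icc (-1) 1) :
    HasCompactSupport f :=
  HasCompactSupport.of_support_subset_isCompact isCompact_Icc hs

lemma norm_extOp_le (hs : Function.support f ⊆ Icc (-1) 1) (z : ℝ × ℝ) :
    ‖extOp f z‖ ≤ ∫ ω, ‖f ω‖ := by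
  rw [extOp_eq_integral hs]
  refine (norm_integral_le_integral_norm _).trans_eq ?_
  simp only [norm_mul, norm_exp_I_mul_ofReal, one_mul]

lemma continuous_extOp (hf : Continuous f) (hs : Function.support f ⊆ Icc (-1) 1) :
    Continuous (extOp f) := by
  rw [funext (extOp_eq_integral hs)]
  refine continuous_of_dominated (bound := fun ω ↦ ‖f ω‖)
    (fun z ↦ by fun_prop) (fun z ↦ ae_of_all _ fun ω ↦ ?_)
    (hf.integrable_of_hasCompactSupport (hasCompactSupport_of_support_subset_Icc hs)).norm
    (ae_of_all _ fun ω ↦ by fun_prop)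
  rw [norm_mul, norm_exp_I_mul_ofReal, one_mul]

lemma extOp_pow_three (hs : Function.support f ⊆ Icc (-1) 1) (z : ℝ × ℝ) :
    extOp f z ^ 3 = ∫ ω : ℝ × ℝ × ℝ,
      Complex.exp (Complex.I * (((ω.1 ^ 2 + ω.2.1 ^ 2 + ω.2.2 ^ 2) * z.2 +
        (ω.1 + ω.2.1 + ω.2.2) * z.1 : ℝ) : ℂ)) * (f ω.1 * (f ω.2.1 * f ω.2.2)) := by
  rw [extOp_eq_integral hs]
  set k : ℝ → ℂ := fun ω ↦
    Complex.exp (Complex.I * ((ω ^ 2 * z.2 + ω * z.1 : ℝ) : ℂ)) * f ω with hk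
  have e (ω : ℝ × ℝ × ℝ) : Complex.exp (Complex.I * (((ω.1 ^ 2 + ω.2.1 ^ 2 + ω.2.2 ^ 2) * z.2 +
        (ω.1 + ω.2.1 + ω.2.2) * z.1 : ℝ) : ℂ)) * (f ω.1 * (f ω.2.1 * f ω.2.2)) =
      k ω.1 * (fun η : ℝ × ℝ ↦ k η.1 * k η.2) ω.2 := by
    have : Complex.I * (((ω.1 ^ 2 + ω.2.1 ^ 2 + ω.2.2 ^ 2) * z.2 +
        (ω.1 + ω.2.1 + ω.2.2) * z.1 : ℝ) : ℂ) =
        Complex.I * ((ω.1 ^ 2 * z.2 + ω.1 * z.1 : ℝ) : ℂ) +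
        (Complex.I * ((ω.2.1 ^ 2 * z.2 + ω.2.1 * z.1 : ℝ) : ℂ) +
        Complex.I * ((ω.2.2 ^ 2 * z.2 + ω.2.2 * z.1 : ℝ) : ℂ)) := by
      push_cast; ring
    rw [this, Complex.exp_add, Complex.exp_add]
    simp only [hk]
    ring
  simp only [e]
  rw [Measure.volume_eq_prod ℝ (ℝ × ℝ), integral_prod_mul k fun η : ℝ × ℝ ↦ k η.1 * k η.2,
    Measure.volume_eq_prod ℝ ℝ, integral_prod_mul]
  ring

lemma lintegral_enorm_sq_prod (hf : Continuous f) :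
    ∫⁻ ω : ℝ × ℝ × ℝ, ‖f ω.1 * (f ω.2.1 * f ω.2.2)‖ₑ ^ 2 = (∫⁻ ω, ‖f ω‖ₑ ^ 2) ^ 3 := by
  have e (ω : ℝ × ℝ × ℝ) : ‖f ω.1 * (f ω.2.1 * f ω.2.2)‖ₑ ^ 2 =
      ‖f ω.1‖ₑ ^ 2 * (fun η : ℝ × ℝ ↦ ‖f η.1‖ₑ ^ 2 * ‖f η.2‖ₑ ^ 2) ω.2 := by
    simp only [enorm_mul]; ring
  simp only [e]
  rw [Measure.volume_eq_prod ℝ (ℝ × ℝ),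
    lintegral_prod_mul (f := fun x ↦ ‖f x‖ₑ ^ 2)
      (g := fun η : ℝ × ℝ ↦ ‖f η.1‖ₑ ^ 2 * ‖f η.2‖ₑ ^ 2) (by fun_prop) (by fun_prop),
    Measure.volume_eq_prod ℝ ℝ,
    lintegral_prod_mul (f := fun x ↦ ‖f x‖ₑ ^ 2) (g := fun x ↦ ‖f x‖ₑ ^ 2)
      (by fun_prop) (by fun_prop)]
  ring

end extOp

lemma exists_lintegral_extOp_sq_le :
    ∃ C : ℝ≥0∞, C ≠ ∞ ∧ ∀ f : ℝ → ℂ, Continuous f → Function.support f ⊆ Icc (-1) 1 → ∀ R : ℝ,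
      ∫⁻ z in Metric.ball (0 : ℝ × ℝ) R, ‖extOp f z‖ₑ ^ 2 ≤
        C * ENNReal.ofReal R * ∫⁻ ω, ‖f ω‖ₑ ^ 2 := by
  obtain ⟨C, hC, h⟩ := exists_lintegral_sq_exp_inner_le ℝ
  refine ⟨2 * C, ENNReal.mul_ne_top (by simp) hC, fun f hf hs R ↦ ?_⟩
  have hc := hasCompactSupport_of_support_subset_Icc hs
  have key (t : ℝ) : ∫⁻ x, ‖extOp f (x, t)‖ₑ ^ 2 ≤ C * ∫⁻ ω, ‖f ω‖ₑ ^ 2 := by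
    set g : ℝ → ℂ := fun ω ↦ Complex.exp (Complex.I * ((ω ^ 2 * t : ℝ) : ℂ)) * f ω with hg
    have hgc : Continuous g := by fun_prop
    have hgs : HasCompactSupport g := hc.mul_left
    have := h g (hgc.integrable_of_hasCompactSupport hgs) (hgc.memLp_of_hasCompactSupport hgs)
    have e (x : ℝ) : extOp f (x, t) =
        ∫ ω, Complex.exp (Complex.I * (inner ℝ ω x : ℝ)) * g ω := by
      rw [extOp_eq_integral hs]
      congr with ω
      simp only [hg]
      rw [← mul_assoc, ← Complex.exp_add]
      congr 2
      simp
      ring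
    have e' (ω : ℝ) : ‖g ω‖ₑ = ‖f ω‖ₑ := by
      rw [hg, enorm_mul, ← ofReal_norm (Complex.exp _), norm_exp_I_mul_ofReal]
      simp
    simpa only [e, e'] using this
  have hm := continuous_extOp hf hs
  rw [← Prod.mk_zero_zero, ← ball_prod_same, Measure.volume_eq_prod, ← Measure.prod_restrict,
    lintegral_prod_symm _ (by fun_prop)]
  calc _ ≤ ∫⁻ t in Metric.ball (0 : ℝ) R, C * ∫⁻ ω, ‖f ω‖ₑ ^ 2 :=
        lintegral_mono fun t ↦ (setLIntegral_le_lintegral _ _).trans (key t)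
    _ = _ := by
        rw [setLIntegral_const, Real.volume_ball, ENNReal.ofReal_mul (by norm_num)]
        simp
        ring

lemma exists_lintegral_extOp_pow_six_le :
    ∃ C : ℝ≥0∞, C ≠ ∞ ∧ ∀ f : ℝ → ℂ, Continuous f → Function.support f ⊆ Icc (-1) 1 → ∀ R : ℝ,
      ∫⁻ z in Metric.ball (0 : ℝ × ℝ) R, ‖extOp f z‖ₑ ^ 6 ≤ C * (∫⁻ ω, ‖f ω‖ₑ ^ 2) ^ 3 := by
  obtain ⟨C₁, hC₁, h₁⟩ := exists_lintegral_comp_sum_le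
  obtain ⟨C₂, hC₂, h₂⟩ := exists_lintegral_sq_exp_prod_le
  refine ⟨C₁ * C₂, ENNReal.mul_ne_top hC₁ hC₂, fun f hf hs R ↦ ?_⟩
  have hcf := hasCompactSupport_of_support_subset_Icc hs
  have hE := continuous_extOp hf hs
  set B := Metric.ball (0 : ℝ × ℝ) R with hB
  have hBm : MeasurableSet B := Metric.isOpen_ball.measurableSet
  have hBfin : volume B ≠ ∞ := Metric.isBounded_ball.measure_lt_top.ne
  set S := ∫⁻ z in B, ‖extOp f z‖ₑ ^ 6 with hS
  set M := ∫ ω, ‖f ω‖ with hM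
  set u : ℝ × ℝ → ℂ := fun z ↦ (starRingEnd ℂ) (extOp f z ^ 3) with hu
  have huc : Continuous u := by fun_prop
  have hu_le (z : ℝ × ℝ) : ‖u z‖ ≤ M ^ 3 := by
    simp only [hu, RCLike.norm_conj, norm_pow]
    exact pow_le_pow_left₀ (norm_nonneg _) (norm_extOp_le hs z) 3
  set g : ℝ × ℝ → ℂ := B.indicator u with hg
  have hgLp (p : ℝ≥0∞) : MemLp g p := by
    rw [hg, memLp_indicator_iff_restrict hBm]
    have : IsFiniteMeasure (volume.restrict B) := ⟨by simpa using hBfin.lt_top⟩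
    exact MemLp.of_bound huc.aestronglyMeasurable (M ^ 3) (ae_of_all _ hu_le)
  have hg1 : Integrable g := memLp_one_iff_integrable.1 (hgLp 1)
  have hg_sq : ∫⁻ z, ‖g z‖ₑ ^ 2 = S := by
    rw [hS, ← lintegral_indicator hBm]
    refine lintegral_congr fun z ↦ ?_
    by_cases hz : z ∈ B
    · simp only [hg, hu, indicator_of_mem hz, RCLike.enorm_conj, enorm_pow]
      rw [← pow_mul]
    · simp [hg, hz]
  have hS_top : S ≠ ∞ := by
    rw [← hg_sq]
    have := (hgLp 2).eLpNorm_ne_top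
    rw [eLpNorm_eq_lintegral_rpow_enorm_toReal two_ne_zero ENNReal.ofNat_ne_top] at this
    intro h
    simp [h] at this
  set F : ℝ × ℝ × ℝ → ℂ := fun ω ↦ f ω.1 * (f ω.2.1 * f ω.2.2) with hF
  have hFc : Continuous F := by fun_prop
  have hfi : Integrable f := hf.integrable_of_hasCompactSupport hcf
  have hFi : Integrable F := hfi.mul_prod (hfi.mul_prod hfi)
  let T : ℝ × ℝ × ℝ → ℝ × ℝ :=
    fun ω ↦ (ω.1 + ω.2.1 + ω.2.2, ω.1 ^ 2 + ω.2.1 ^ 2 + ω.2.2 ^ 2)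
  let k : ℝ × ℝ → ℝ × ℝ → ℂ := fun w z ↦
    Complex.exp (Complex.I * ((w.2 * z.2 + w.1 * z.1 : ℝ) : ℂ))
  have hk (w z) : ‖k w z‖ = 1 := norm_exp_I_mul_ofReal _
  let G : ℝ × ℝ → ℂ := fun w ↦ ∫ z, k w z * g z
  have hGc : Continuous G := by
    refine continuous_of_dominated (bound := fun z ↦ ‖g z‖) (fun w ↦ ?_)
      (fun w ↦ ae_of_all _ fun z ↦ by rw [norm_mul, hk, one_mul]) hg1.norm
      (ae_of_all _ fun z ↦ by fun_prop)
    exact (by fun_prop : Continuous fun z ↦ k w z).aestronglyMeasurable.mul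
      hg1.aestronglyMeasurable
  have hS_eq : S = ‖∫ z, extOp f z ^ 3 * g z‖ₑ := by
    have e (z) : extOp f z ^ 3 * g z = ((B.indicator (fun z ↦ ‖extOp f z‖ ^ 6) z : ℝ) : ℂ) := by
      by_cases hz : z ∈ B
      · simp only [hg, hu, indicator_of_mem hz]
        rw [Complex.mul_conj, Complex.normSq_eq_norm_sq, norm_pow, ← pow_mul]
      · simp [hg, hz]
    simp only [e]
    rw [integral_complex_ofReal, ← ofReal_norm, Complex.norm_real, Real.norm_eq_abs, abs_of_nonneg
      (integral_nonneg fun z ↦ indicator_nonneg (fun _ _ ↦ by positivity) _),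
      integral_indicator hBm, ofReal_integral_eq_lintegral_ofReal]
    · simp only [hS]
      refine lintegral_congr fun z ↦ ?_
      rw [ENNReal.ofReal_pow (norm_nonneg _), ofReal_norm]
    · have : IsFiniteMeasure (volume.restrict B) := ⟨by simpa using hBfin.lt_top⟩
      refine Integrable.of_bound (by fun_prop) (M ^ 6) (ae_of_all _ fun z ↦ ?_)
      rw [norm_pow, norm_norm]
      exact pow_le_pow_left₀ (norm_nonneg _) (norm_extOp_le hs z) 6
    · exact ae_of_all _ fun z ↦ by positivity
  have hswap : ∫ z, extOp f z ^ 3 * g z = ∫ ω, F ω * G (T ω) := by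
    have e1 (z) : extOp f z ^ 3 * g z = ∫ ω, k (T ω) z * (F ω * g z) := by
      rw [extOp_pow_three hs, ← integral_mul_const]
      exact integral_congr_ae (ae_of_all _ fun ω ↦ by simp only [k, T, hF]; ring)
    have e2 (ω) : F ω * G (T ω) = ∫ z, k (T ω) z * (F ω * g z) := by
      rw [← integral_const_mul]
      exact integral_congr_ae (ae_of_all _ fun z ↦ by simp only; ring)
    simp only [e1, e2]
    refine integral_integral_swap (f := fun z ω ↦ k (T ω) z * (F ω * g z)) ?_
    have hp : Integrable (fun q : (ℝ × ℝ) × (ℝ × ℝ × ℝ) ↦ F q.2 * g q.1)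
        (volume.prod volume) := by
      simpa only [mul_comm] using hg1.mul_prod hFi
    refine hp.bdd_mul (c := 1) ?_ (ae_of_all _ fun q ↦ (hk _ _).le)
    exact (by fun_prop : Continuous fun q : (ℝ × ℝ) × (ℝ × ℝ × ℝ) ↦ k (T q.2) q.1)
      |>.aestronglyMeasurable
  have hS_le : S ≤ ∫⁻ ω, ‖F ω‖ₑ * ‖G (T ω)‖ₑ := by
    rw [hS_eq, hswap]
    refine (enorm_integral_le_lintegral_enorm _).trans_eq ?_
    simp only [enorm_mul]
  have hsq : S * S ≤ C₁ * C₂ * (∫⁻ ω, ‖f ω‖ₑ ^ 2) ^ 3 * S := by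
    calc S * S ≤ (∫⁻ ω, ‖F ω‖ₑ * ‖G (T ω)‖ₑ) ^ 2 := by
          rw [← sq]; exact pow_le_pow_left' hS_le 2
      _ ≤ (∫⁻ ω, ‖F ω‖ₑ ^ 2) * ∫⁻ ω, ‖G (T ω)‖ₑ ^ 2 :=
          sq_lintegral_mul_le (by fun_prop) (by fun_prop)
      _ ≤ (∫⁻ ω, ‖f ω‖ₑ ^ 2) ^ 3 * (C₁ * (C₂ * S)) := by
          gcongr
          · exact (lintegral_enorm_sq_prod hf).le
          · refine (h₁ (fun w ↦ ‖G w‖ₑ ^ 2) (by fun_prop)).trans ?_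
            gcongr
            rw [← hg_sq]
            exact h₂ g hg1 (hgLp 2)
      _ = _ := by ring
  rcases eq_or_ne S 0 with h0 | h0
  · simp [h0]
  · exact (ENNReal.mul_le_mul_iff_left h0 hS_top).1 hsq

lemma lintegral_rpow_le_of_two_six {α : Type*} [MeasurableSpace α] {μ : Measure α}
    {h : α → ℝ≥0∞} (hh : AEMeasurable h μ) {p : ℝ} (hp2 : 2 ≤ p) (hp6 : p ≤ 6) :
    ∫⁻ a, h a ^ p ∂μ ≤
      (∫⁻ a, h a ^ 2 ∂μ) ^ ((6 - p) / 4) * (∫⁻ a, h a ^ 6 ∂μ) ^ ((p - 2) / 4) := by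
  have hα : 0 ≤ (6 - p) / 4 := by linarith
  have hβ : 0 ≤ (p - 2) / 4 := by linarith
  have e (x : ℝ≥0∞) : x ^ p = (x ^ 2) ^ ((6 - p) / 4) * (x ^ 6) ^ ((p - 2) / 4) := by
    rw [← ENNReal.rpow_natCast, ← ENNReal.rpow_natCast, ← ENNReal.rpow_mul, ← ENNReal.rpow_mul,
      ← ENNReal.rpow_add_of_nonneg _ _ (by positivity) (by positivity)]
    congr 1
    push_cast
    ring
  simp only [e]
  exact ENNReal.lintegral_mul_norm_pow_le (hh.pow_const 2) (hh.pow_const 6) hα hβ (by ring)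

/-- **Strichartz estimate on a ball** (equation (1.7) of the paper):
for each `p ∈ [2,6]` there is a constant `C_p`, depending only on `p`, such that for
every `R > 0` and every smooth `f : ℝ → ℂ` supported in `[-1,1]`,
`‖Ef‖_{L^p(B_R)} ≤ C_p · R^{3/(2p) - 1/4} · ‖f‖_{L²}`. -/
theorem strichartz_on_ball (p : ℝ) (hp2 : 2 ≤ p) (hp6 : p ≤ 6) :
    ∃ C : ℝ, ∀ R : ℝ, 0 < R → ∀ f : ℝ → ℂ, ContDiff ℝ (⊤ : ℕ∞) f →
      Function.support f ⊆ Icc (-1) 1 →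
      LpBall (extOp f) p R ≤ ENNReal.ofReal (C * R ^ (3 / (2 * p) - 1 / 4) * L2norm f) := by
  obtain ⟨C₂, hC₂, h₂⟩ := exists_lintegral_extOp_sq_le
  obtain ⟨C₆, hC₆, h₆⟩ := exists_lintegral_extOp_pow_six_le
  have hp0 : 0 < p := by linarith
  have hα : 0 ≤ (6 - p) / 4 := by linarith
  have hβ : 0 ≤ (p - 2) / 4 := by linarith
  set K : ℝ≥0∞ := (C₂ ^ ((6 - p) / 4) * C₆ ^ ((p - 2) / 4)) ^ (1 / p) with hK
  have hK_top : K ≠ ∞ := ENNReal.rpow_ne_top_of_nonneg (by positivity) <|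
    ENNReal.mul_ne_top (ENNReal.rpow_ne_top_of_nonneg hα hC₂)
      (ENNReal.rpow_ne_top_of_nonneg hβ hC₆)
  refine ⟨K.toReal, fun R hR f hf hs ↦ ?_⟩
  have hfc := hf.continuous
  have hf_top : eLpNorm f 2 volume ≠ ∞ := (hfc.memLp_of_hasCompactSupport (μ := volume)
    (hasCompactSupport_of_support_subset_Icc hs)).eLpNorm_ne_top
  set N := ∫⁻ ω, ‖f ω‖ₑ ^ 2 with hN
  have hL2 : eLpNorm f 2 volume = N ^ (1 / 2 : ℝ) := by
    simp [eLpNorm_eq_lintegral_rpow_enorm_toReal two_ne_zero ENNReal.ofNat_ne_top, hN]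
  rw [ENNReal.ofReal_mul (by positivity), ENNReal.ofReal_mul (by positivity), L2norm,
    ENNReal.ofReal_toReal hf_top, ENNReal.ofReal_toReal hK_top, hL2,
    ← ENNReal.ofReal_rpow_of_pos hR, LpBall,
    eLpNorm_eq_lintegral_rpow_enorm_toReal (by simpa using hp0) ENNReal.ofReal_ne_top,
    ENNReal.toReal_ofReal hp0.le]
  have hint := lintegral_rpow_le_of_two_six (μ := volume.restrict (Metric.ball (0 : ℝ × ℝ) R))
    (continuous_extOp hfc hs).enorm.aemeasurable hp2 hp6
  calc _ ≤ ((C₂ * ENNReal.ofReal R * N) ^ ((6 - p) / 4) *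
        (C₆ * N ^ 3) ^ ((p - 2) / 4)) ^ (1 / p) := by
        gcongr
        exact hint.trans (by gcongr; exacts [h₂ f hfc hs R, h₆ f hfc hs R])
    _ = ((C₂ ^ ((6 - p) / 4) * C₆ ^ ((p - 2) / 4)) * ENNReal.ofReal R ^ ((6 - p) / 4) *
        N ^ (p / 2)) ^ (1 / p) := by
        have e : N ^ (p / 2) = N ^ ((6 - p) / 4) * (N ^ 3) ^ ((p - 2) / 4) := by
          rw [← ENNReal.rpow_natCast, ← ENNReal.rpow_mul,
            ← ENNReal.rpow_add_of_nonneg _ _ hα (by positivity)]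
          congr 1
          push_cast
          ring
        rw [e, ENNReal.mul_rpow_of_nonneg _ _ hα, ENNReal.mul_rpow_of_nonneg _ _ hα,
          ENNReal.mul_rpow_of_nonneg _ _ hβ]
        ring_nf
    _ = _ := by
        have eR : (6 - p) / 4 * (1 / p) = 3 / (2 * p) - 1 / 4 := by
          field_simp
          ring
        have eN : p / 2 * (1 / p) = 1 / 2 := by field_simp
        rw [ENNReal.mul_rpow_of_nonneg _ _ (by positivity),
          ENNReal.mul_rpow_of_nonneg _ _ (by positivity), ← hK, ← ENNReal.rpow_mul,
          ← ENNReal.rpow_mul, eR, eN]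

end
end

section
/- There is an absolute constant c > 0 such that for all sufficiently large R and all positive integers N with N < R^{1/2}, one has ∫_{B_R} |Ef_{R,N}|⁴ ≥ c · R^{-1/2} · N^{-1}. -/
open MeasureTheory Real Set ENNReal

noncomputable section

/-- The bump `Θ` of the bundle scenario: smooth, `0 ≤ Θ ≤ 1`, identically `1` on
`[-(1/2)R^{-1/2}N⁻¹, (1/2)R^{-1/2}N⁻¹]`, and supported in
`[-R^{-1/2}N⁻¹, R^{-1/2}N⁻¹]`. -/
def IsBundleBump (R : ℝ) (N : ℕ) (Θ : ℝ → ℝ) : Prop :=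
  ContDiff ℝ (⊤ : ℕ∞) Θ ∧ (∀ ω, 0 ≤ Θ ω ∧ Θ ω ≤ 1) ∧
    (∀ ω : ℝ, |ω| ≤ 1 / 2 * R ^ (-(1 : ℝ) / 2) * (N : ℝ)⁻¹ → Θ ω = 1) ∧
    Function.support Θ ⊆
      Icc (-(R ^ (-(1 : ℝ) / 2) * (N : ℝ)⁻¹)) (R ^ (-(1 : ℝ) / 2) * (N : ℝ)⁻¹)

/-- The bundle-scenario function `f_{R,N}(ω) = Σ_{n=-N}^{N} Θ(ω - nR^{-1/2})`. -/
def bundleFn (R : ℝ) (N : ℕ) (Θ : ℝ → ℝ) : ℝ → ℂ := fun ω =>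
  ((∑ n ∈ Finset.Icc (-(N : ℤ)) (N : ℤ), Θ (ω - (n : ℝ) * R ^ (-(1 : ℝ) / 2)) : ℝ) : ℂ)

/-- The squared modulus of the total oscillatory integral `∫ e^{iφ} dρ` as a double integral. -/
theorem norm_sq_integral_exp_I_mul {X : Type*} [MeasurableSpace X] (ρ : Measure X)
    [IsFiniteMeasure ρ] {φ : X → ℝ} (hφ : Measurable φ) :
    ‖∫ x, Complex.exp (Complex.I * (φ x : ℂ)) ∂ρ‖ ^ 2 =
      ∫ p, Real.cos (φ p.1 - φ p.2) ∂(ρ.prod ρ) := by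
  have hcos : Integrable (fun x => Real.cos (φ x)) ρ :=
    Integrable.of_bound (by fun_prop) 1 (ae_of_all _ fun x => Real.abs_cos_le_one _)
  have hsin : Integrable (fun x => Real.sin (φ x)) ρ :=
    Integrable.of_bound (by fun_prop) 1 (ae_of_all _ fun x => Real.abs_sin_le_one _)
  have hexp : Integrable (fun x => Complex.exp (Complex.I * (φ x : ℂ))) ρ :=
    Integrable.of_bound (by fun_prop) 1
      (ae_of_all _ fun x => by rw [mul_comm, Complex.norm_exp_ofReal_mul_I])
  have hre : (∫ x, Complex.exp (Complex.I * (φ x : ℂ)) ∂ρ).re = ∫ x, Real.cos (φ x) ∂ρ := by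
    rw [← RCLike.re_eq_complex_re, ← integral_re hexp]
    simp [mul_comm Complex.I, Complex.exp_ofReal_mul_I_re]
  have him : (∫ x, Complex.exp (Complex.I * (φ x : ℂ)) ∂ρ).im = ∫ x, Real.sin (φ x) ∂ρ := by
    rw [← RCLike.im_eq_complex_im, ← integral_im hexp]
    simp [mul_comm Complex.I, Complex.exp_ofReal_mul_I_im]
  rw [Complex.sq_norm, Complex.normSq_apply, hre, him, ← integral_prod_mul, ← integral_prod_mul,
    ← integral_add (hcos.mul_prod hcos) (hsin.mul_prod hsin)]
  simp [Real.cos_sub]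

/-- Exchanging the roles of the two measures in an averaged squared oscillatory integral. -/
theorem integral_norm_sq_integral_exp_swap {X S : Type*} [MeasurableSpace X] [MeasurableSpace S]
    (μ : Measure X) (κ : Measure S) [IsFiniteMeasure μ] [IsFiniteMeasure κ] {Φ : X → S → ℝ}
    (hΦ : Measurable (Function.uncurry Φ)) :
    ∫ s, ‖∫ a, Complex.exp (Complex.I * ((Φ a s.1 - Φ a s.2 : ℝ) : ℂ)) ∂μ‖ ^ 2 ∂(κ.prod κ) =
      ∫ a, ‖∫ s, Complex.exp (Complex.I * ((Φ a.1 s - Φ a.2 s : ℝ) : ℂ)) ∂κ‖ ^ 2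
        ∂(μ.prod μ) := by
  have h₁ : ∀ s, Measurable fun a => Φ a s := fun s =>
    hΦ.comp (by fun_prop : Measurable fun a => (a, s))
  have h₂ : ∀ a, Measurable fun s => Φ a s := fun a =>
    hΦ.comp (by fun_prop : Measurable fun s => (a, s))
  have hcomp : ∀ {f : (S × S) × (X × X) → X} {g : (S × S) × (X × X) → S}, Measurable f →
      Measurable g → Measurable fun p => Φ (f p) (g p) := fun hf hg => hΦ.comp (hf.prodMk hg)
  have hL : ∀ s : S × S, ‖∫ a, Complex.exp (Complex.I * ((Φ a s.1 - Φ a s.2 : ℝ) : ℂ)) ∂μ‖ ^ 2 =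
      ∫ p, Real.cos ((Φ p.1 s.1 - Φ p.1 s.2) - (Φ p.2 s.1 - Φ p.2 s.2)) ∂(μ.prod μ) := fun s =>
    norm_sq_integral_exp_I_mul μ ((h₁ _).sub (h₁ _))
  have hR : ∀ a : X × X, ‖∫ s, Complex.exp (Complex.I * ((Φ a.1 s - Φ a.2 s : ℝ) : ℂ)) ∂κ‖ ^ 2 =
      ∫ s, Real.cos ((Φ a.1 s.1 - Φ a.2 s.1) - (Φ a.1 s.2 - Φ a.2 s.2)) ∂(κ.prod κ) := fun a =>
    norm_sq_integral_exp_I_mul κ ((h₂ _).sub (h₂ _))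
  simp_rw [hL, hR]
  rw [integral_integral_swap]
  · simp_rw [sub_sub_sub_comm]
  · refine Integrable.of_bound (Measurable.aestronglyMeasurable ?_) 1
      (ae_of_all _ fun x => Real.abs_cos_le_one _)
    refine Real.measurable_cos.comp (((hcomp ?_ ?_).sub (hcomp ?_ ?_)).sub
      ((hcomp ?_ ?_).sub (hcomp ?_ ?_))) <;> fun_prop

/-- The Fourier extension of a measure on the parabola. -/
def parabolaExt (μ : Measure ℝ) (z : ℝ × ℝ) : ℂ :=
  ∫ ω, Complex.exp (Complex.I * ((ω ^ 2 * z.2 + ω * z.1 : ℝ) : ℂ)) ∂μ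

theorem norm_parabolaExt_le (μ : Measure ℝ) (z : ℝ × ℝ) : ‖parabolaExt μ z‖ ≤ μ.real univ := by
  refine (norm_integral_le_integral_norm _).trans ?_
  simp [mul_comm Complex.I, Complex.norm_exp_ofReal_mul_I, -Complex.ofReal_add,
    -Complex.ofReal_mul]

theorem continuous_parabolaExt (μ : Measure ℝ) [IsFiniteMeasure μ] :
    Continuous (parabolaExt μ) := by
  refine continuous_of_dominated (bound := fun _ => 1) (fun z => ?_) (fun z => ?_)
    (integrable_const _) (ae_of_all _ fun ω => ?_)
  · exact (by fun_prop : Continuous fun ω : ℝ =>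
      Complex.exp (Complex.I * ((ω ^ 2 * z.2 + ω * z.1 : ℝ) : ℂ))).aestronglyMeasurable
  · exact ae_of_all _ fun ω => by rw [mul_comm, Complex.norm_exp_ofReal_mul_I]
  · fun_prop

/-- If the phase differences of `ω, ω'` are at most one on `Q` for all pairs in `D`, then the
averaged `L²` norm of the extension over `Q - Q` is bounded below by the mass of `D`. -/
theorem le_integral_norm_sq_parabolaExt_sub (μ : Measure ℝ) [IsFiniteMeasure μ]
    {Q D : Set (ℝ × ℝ)} (hQ : MeasurableSet Q) (hQfin : volume Q ≠ ∞) (hD : MeasurableSet D)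
    (hDQ : ∀ p ∈ D, ∀ z ∈ Q, |(p.1 ^ 2 * z.2 + p.1 * z.1) - (p.2 ^ 2 * z.2 + p.2 * z.1)| ≤ 1) :
    (volume.real Q / 2) ^ 2 * (μ.prod μ).real D ≤
      ∫ s, ‖parabolaExt μ (s.1 - s.2)‖ ^ 2 ∂((volume.restrict Q).prod (volume.restrict Q)) := by
  have : IsFiniteMeasure (volume.restrict Q) := ⟨by simpa using hQfin.lt_top⟩
  have hswap := integral_norm_sq_integral_exp_swap μ (volume.restrict Q)
    (Φ := fun ω z => ω ^ 2 * z.2 + ω * z.1) (by unfold Function.uncurry; fun_prop)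
  have hL : ∀ s : (ℝ × ℝ) × (ℝ × ℝ), parabolaExt μ (s.1 - s.2) =
      ∫ ω, Complex.exp (Complex.I * (((ω ^ 2 * s.1.2 + ω * s.1.1) -
        (ω ^ 2 * s.2.2 + ω * s.2.1) : ℝ) : ℂ)) ∂μ := fun s => by
    unfold parabolaExt
    congr! 5
    simp only [Prod.fst_sub, Prod.snd_sub]
    ring
  simp_rw [hL, hswap]
  set K : ℝ × ℝ → ℂ := fun p => ∫ z in Q, Complex.exp (Complex.I *
    (((p.1 ^ 2 * z.2 + p.1 * z.1) - (p.2 ^ 2 * z.2 + p.2 * z.1) : ℝ) : ℂ))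
  have hexp : ∀ p : ℝ × ℝ, Integrable (fun z : ℝ × ℝ => Complex.exp (Complex.I *
      (((p.1 ^ 2 * z.2 + p.1 * z.1) - (p.2 ^ 2 * z.2 + p.2 * z.1) : ℝ) : ℂ)))
      (volume.restrict Q) := fun p =>
    Integrable.of_bound (Continuous.aestronglyMeasurable (by fun_prop)) 1
      (ae_of_all _ fun z => by rw [mul_comm, Complex.norm_exp_ofReal_mul_I])
  have hKcont : Continuous K := by
    refine continuous_of_dominated (bound := fun _ => 1) (fun p => (hexp p).1) (fun p => ?_)
      (integrable_const _) (ae_of_all _ fun z => ?_)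
    · exact ae_of_all _ fun z => by rw [mul_comm, Complex.norm_exp_ofReal_mul_I]
    · fun_prop
  have hKle : ∀ p, ‖K p‖ ≤ volume.real Q := fun p => by
    refine (norm_integral_le_integral_norm _).trans ?_
    simp only [mul_comm Complex.I, Complex.norm_exp_ofReal_mul_I]
    simp
  have hKge : ∀ p ∈ D, volume.real Q / 2 ≤ ‖K p‖ := fun p hp => by
    refine le_trans ?_ (Complex.re_le_norm _)
    rw [← RCLike.re_eq_complex_re, ← integral_re (hexp p)]
    have : volume.real Q / 2 = ∫ z in Q, (1 / 2 : ℝ) := by simp [div_eq_mul_inv]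
    rw [this]
    refine setIntegral_mono_on (integrable_const _) (hexp p).re hQ fun z hz => ?_
    rw [mul_comm Complex.I, RCLike.re_eq_complex_re, Complex.exp_ofReal_mul_I_re]
    have h₁ := Real.one_sub_sq_div_two_le_cos
      (x := (p.1 ^ 2 * z.2 + p.1 * z.1) - (p.2 ^ 2 * z.2 + p.2 * z.1))
    have h₂ := (sq_le_one_iff_abs_le_one _).2 (hDQ p hp z hz)
    linarith
  have hint : Integrable (fun p => ‖K p‖ ^ 2) (μ.prod μ) :=
    Integrable.of_bound (Continuous.aestronglyMeasurable (by fun_prop)) (volume.real Q ^ 2)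
      (ae_of_all _ fun p => by
        rw [norm_pow, norm_norm]
        exact pow_le_pow_left₀ (norm_nonneg _) (hKle p) 2)
  calc (volume.real Q / 2) ^ 2 * (μ.prod μ).real D
      = ∫ p in D, (volume.real Q / 2) ^ 2 ∂(μ.prod μ) := by simp [mul_comm]
    _ ≤ ∫ p in D, ‖K p‖ ^ 2 ∂(μ.prod μ) :=
        setIntegral_mono_on (by simp) hint.integrableOn hD fun p hp =>
          pow_le_pow_left₀ (by positivity) (hKge p hp) 2
    _ ≤ ∫ p, ‖K p‖ ^ 2 ∂(μ.prod μ) :=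
        setIntegral_le_integral hint (ae_of_all _ fun p => by positivity)

/-- A lower bound on the averaged `L²` norm over `Q - Q` forces, by convexity, a lower bound on
the `L⁴` norm over any set containing `Q - Q`. -/
theorem le_lintegral_norm_pow_four {F : ℝ × ℝ → ℂ} (hF : Continuous F) {C : ℝ}
    (hC : ∀ z, ‖F z‖ ≤ C) {Q B : Set (ℝ × ℝ)} (hB : MeasurableSet B) (hQ : MeasurableSet Q)
    (hQfin : volume Q ≠ ∞) (hQpos : 0 < volume.real Q) (hQB : ∀ s ∈ Q, ∀ s' ∈ Q, s - s' ∈ B)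
    {a : ℝ} (ha : 0 ≤ a)
    (h : volume.real Q ^ 2 * a ≤
      ∫ s, ‖F (s.1 - s.2)‖ ^ 2 ∂((volume.restrict Q).prod (volume.restrict Q))) :
    ENNReal.ofReal (volume.real Q * a ^ 2) ≤ ∫⁻ z in B, (‖F z‖₊ : ℝ≥0∞) ^ 4 := by
  have : IsFiniteMeasure (volume.restrict Q) := ⟨by simpa using hQfin.lt_top⟩
  set ν := (volume.restrict Q).prod (volume.restrict Q) with hν
  have hν_univ : ν.real univ = volume.real Q ^ 2 := by
    rw [hν, ← Set.univ_prod_univ, measureReal_prod_prod, measureReal_restrict_apply_univ, sq]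
  have hint : ∀ k : ℕ, Integrable (fun s : (ℝ × ℝ) × (ℝ × ℝ) => ‖F (s.1 - s.2)‖ ^ k) ν := fun k =>
    Integrable.of_bound (Continuous.aestronglyMeasurable (by fun_prop)) (C ^ k)
      (ae_of_all _ fun p => by
        rw [norm_pow, norm_norm]
        exact pow_le_pow_left₀ (norm_nonneg _) (hC _) k)
  have hlower : volume.real Q ^ 2 * a ^ 2 ≤ ∫ s, ‖F (s.1 - s.2)‖ ^ 4 ∂ν := by
    have hmono : ∫ s, (2 * a * ‖F (s.1 - s.2)‖ ^ 2 - a ^ 2) ∂ν ≤ ∫ s, ‖F (s.1 - s.2)‖ ^ 4 ∂ν :=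
      integral_mono (((hint 2).const_mul _).sub (integrable_const _)) (hint 4) fun s => by
        nlinarith [sq_nonneg (‖F (s.1 - s.2)‖ ^ 2 - a)]
    rw [integral_sub ((hint 2).const_mul _) (integrable_const _), integral_const_mul,
      integral_const, hν_univ, smul_eq_mul] at hmono
    nlinarith [mul_le_mul_of_nonneg_left h ha]
  have hupper : ENNReal.ofReal (∫ s, ‖F (s.1 - s.2)‖ ^ 4 ∂ν) ≤
      volume Q * ∫⁻ z in B, (‖F z‖₊ : ℝ≥0∞) ^ 4 := by
    rw [ofReal_integral_eq_lintegral_ofReal (hint 4) (ae_of_all _ fun s => by positivity)]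
    have hpt : ∀ z, ENNReal.ofReal (‖F z‖ ^ 4) = (‖F z‖₊ : ℝ≥0∞) ^ 4 := fun z => by
      rw [ENNReal.ofReal_pow (norm_nonneg _), ofReal_norm, enorm_eq_nnnorm]
    simp_rw [hpt]
    rw [lintegral_prod_symm' _ (by fun_prop)]
    calc ∫⁻ s' in Q, ∫⁻ s in Q, (‖F (s - s')‖₊ : ℝ≥0∞) ^ 4
        ≤ ∫⁻ s' in Q, ∫⁻ z in B, (‖F z‖₊ : ℝ≥0∞) ^ 4 := by
          refine setLIntegral_mono' hQ fun s' hs' => ?_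
          rw [← lintegral_indicator hQ, ← lintegral_indicator hB,
            ← lintegral_sub_right_eq_self (B.indicator _) s']
          refine lintegral_mono fun s => ?_
          by_cases hs : s ∈ Q
          · simp [hs, hQB s hs s' hs']
          · simp [hs]
      _ = _ := by rw [setLIntegral_const, mul_comm]
  have hle := (ENNReal.ofReal_le_ofReal hlower).trans hupper
  have hsplit : ENNReal.ofReal (volume.real Q ^ 2 * a ^ 2) =
      volume Q * ENNReal.ofReal (volume.real Q * a ^ 2) := by
    rw [← ofReal_measureReal hQfin, ← ENNReal.ofReal_mul measureReal_nonneg]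
    congr 1
    ring
  rw [hsplit] at hle
  refine (ENNReal.mul_le_mul_iff_right (fun h0 => ?_) hQfin).1 hle
  simp [Measure.real, h0] at hQpos

/-- The positive measure on `[-1,1]` with density the bundle-scenario function. -/
def bundleMeasure (R : ℝ) (N : ℕ) (Θ : ℝ → ℝ) : Measure ℝ :=
  (volume.restrict (Icc (-1) 1)).withDensity fun ω =>
    ENNReal.ofReal (∑ n ∈ Finset.Icc (-(N : ℤ)) (N : ℤ), Θ (ω - (n : ℝ) * R ^ (-(1 : ℝ) / 2)))

theorem isFiniteMeasure_bundleMeasure {R : ℝ} {N : ℕ} {Θ : ℝ → ℝ} (hΘ : Continuous Θ) :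
    IsFiniteMeasure (bundleMeasure R N Θ) :=
  isFiniteMeasure_withDensity_ofReal
    (Continuous.integrableOn_Icc (by fun_prop)).2

theorem extOp_bundleFn {R : ℝ} {N : ℕ} {Θ : ℝ → ℝ} (hΘ : Continuous Θ) (hpos : ∀ ω, 0 ≤ Θ ω) :
    extOp (bundleFn R N Θ) = parabolaExt (bundleMeasure R N Θ) := by
  ext z
  unfold extOp parabolaExt bundleMeasure bundleFn
  rw [integral_withDensity_eq_integral_toReal_smul (by fun_prop)
    (ae_of_all _ fun _ => ENNReal.ofReal_lt_top)]
  refine integral_congr_ae (ae_of_all _ fun ω => ?_)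
  simp only
  rw [ENNReal.toReal_ofReal (Finset.sum_nonneg fun n _ => hpos _), Complex.real_smul, mul_comm]

/-- An interval on which one of the bumps is `1` has at least its length as mass. -/
theorem volume_le_bundleMeasure {R : ℝ} {N : ℕ} {Θ : ℝ → ℝ} (hpos : ∀ ω, 0 ≤ Θ ω)
    {I : Set ℝ} (hI : MeasurableSet I) (hI₁ : I ⊆ Icc (-1) 1) {n : ℤ}
    (hn : n ∈ Finset.Icc (-(N : ℤ)) N)
    (hone : ∀ ω ∈ I, Θ (ω - (n : ℝ) * R ^ (-(1 : ℝ) / 2)) = 1) :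
    volume I ≤ bundleMeasure R N Θ I := by
  rw [bundleMeasure, withDensity_apply _ hI, Measure.restrict_restrict hI,
    inter_eq_left.2 hI₁, ← setLIntegral_one]
  refine setLIntegral_mono' hI fun ω hω => ?_
  rw [← ENNReal.ofReal_one]
  exact ENNReal.ofReal_le_ofReal ((hone ω hω).symm.le.trans (Finset.single_le_sum
    (f := fun m : ℤ => Θ (ω - (m : ℝ) * R ^ (-(1 : ℝ) / 2))) (fun m _ => hpos _) hn))

/-- The `k`-th interval of length `η` centred at the points of the progression `ℕ • δ`. -/
def tile (δ η : ℝ) (k : ℕ) : Set ℝ := Ico (k * δ - η / 2) (k * δ + η / 2)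

theorem measurableSet_tile (δ η : ℝ) (k : ℕ) : MeasurableSet (tile δ η k) := measurableSet_Ico

theorem pairwise_disjoint_tile {δ η : ℝ} (hη : 0 ≤ η) (hηδ : η ≤ δ) :
    Pairwise (Function.onFun Disjoint (tile δ η)) := by
  rw [pairwise_disjoint_on]
  intro m n hmn
  rw [tile, tile, Set.Ico_disjoint_Ico, min_def, max_def]
  have : (m : ℝ) + 1 ≤ n := by exact_mod_cast hmn
  have := mul_le_mul_of_nonneg_right this (hη.trans hηδ)
  split_ifs <;> linarith

/-- The union of the squares of the first `N` tiles has mass at least `N η²`. -/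
theorem le_prod_biUnion_tile {μ : Measure ℝ} [IsFiniteMeasure μ] {δ η : ℝ} {N : ℕ} (hη : 0 ≤ η)
    (hηδ : η ≤ δ) (hμ : ∀ k < N, ENNReal.ofReal η ≤ μ (tile δ η k)) :
    N * η ^ 2 ≤ (μ.prod μ).real (⋃ k ∈ Finset.range N, tile δ η k ×ˢ tile δ η k) := by
  rw [measureReal_biUnion_finset
    (fun i _ j _ hij => Set.disjoint_prod.2 (Or.inl (pairwise_disjoint_tile hη hηδ hij)))
    (fun k _ => (measurableSet_tile δ η k).prod (measurableSet_tile δ η k))]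
  refine le_trans (le_of_eq (by simp)) (Finset.sum_le_sum (f := fun _ => η ^ 2) fun k hk => ?_)
  rw [measureReal_prod_prod, sq]
  have : η ≤ μ.real (tile δ η k) :=
    (ENNReal.ofReal_le_iff_le_toReal (measure_ne_top _ _)).1 (hμ k (Finset.mem_range.1 hk))
  exact mul_le_mul this this hη measureReal_nonneg

/-- **`L⁴` lower bound for the bundle scenario**: there is an absolute constant
`c > 0` such that for all sufficiently large `R` and positive integers `N < R^{1/2}`,
`∫_{B_R} |Ef_{R,N}|⁴ ≥ c · R^{-1/2} · N⁻¹`. -/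
theorem bundle_L4_lower_bound :
    ∃ c : ℝ, 0 < c ∧ ∃ R₀ : ℝ, ∀ R : ℝ, R₀ ≤ R → ∀ N : ℕ, 0 < N →
      (N : ℝ) < R ^ ((1 : ℝ) / 2) → ∀ Θ : ℝ → ℝ, IsBundleBump R N Θ →
      ENNReal.ofReal (c * R ^ (-(1 : ℝ) / 2) * (N : ℝ)⁻¹) ≤
        ∫⁻ z in Metric.ball (0 : ℝ × ℝ) R, (‖extOp (bundleFn R N Θ) z‖₊ : ℝ≥0∞) ^ 4 := by
  refine ⟨1 / 128, by norm_num, 1, fun R hR N hN hNR Θ ⟨hsmooth, hΘ, hone, _⟩ => ?_⟩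
  have hcont : Continuous Θ := hsmooth.continuous
  have hpos : ∀ ω, 0 ≤ Θ ω := fun ω => (hΘ ω).1
  have hfin := isFiniteMeasure_bundleMeasure (R := R) (N := N) hcont
  have hR₀ : 0 < R := by linarith
  have hN₁ : (1 : ℝ) ≤ N := by exact_mod_cast hN
  have hN₀ : (0 : ℝ) < N := by linarith
  set δ : ℝ := R ^ (-(1 : ℝ) / 2) with hδ
  have hδ₀ : 0 < δ := Real.rpow_pos_of_pos hR₀ _
  have hδsq : δ ^ 2 * R = 1 := by
    rw [hδ, ← Real.rpow_natCast, ← Real.rpow_mul hR₀.le]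
    norm_num [Real.rpow_neg_one, hR₀.ne']
  have hhalf : R ^ ((1 : ℝ) / 2) * δ = 1 := by
    rw [hδ, ← Real.rpow_add hR₀]
    norm_num
  have hNδ : N * δ < 1 := hhalf ▸ mul_lt_mul_of_pos_right hNR hδ₀
  obtain ⟨η, hη⟩ : ∃ η, η = δ * (N : ℝ)⁻¹ := ⟨_, rfl⟩
  have hηN : η * N = δ := by rw [hη]; field_simp
  have hη₀ : 0 < η := by rw [hη]; positivity
  have hηδ : η ≤ δ := by nlinarith
  set μ := bundleMeasure R N Θ
  have htile_sub : ∀ k < N, ∀ ω ∈ tile δ η k, -(N * δ) ≤ ω ∧ ω ≤ N * δ := fun k hk ω hω => by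
    have : (k : ℝ) + 1 ≤ N := by exact_mod_cast hk
    have := mul_le_mul_of_nonneg_right this hδ₀.le
    have : 0 ≤ k * δ := by positivity
    constructor <;> nlinarith [hω.1, hω.2]
  have hμtile : ∀ k < N, ENNReal.ofReal η ≤ μ (tile δ η k) := fun k hk => by
    have hvol : volume (tile δ η k) = ENNReal.ofReal η := by
      rw [tile, Real.volume_Ico]
      congr 1
      ring
    rw [← hvol]
    refine volume_le_bundleMeasure hpos measurableSet_Ico (fun ω hω => ?_) (n := k) ?_
      fun ω hω => hone _ ?_
    · obtain ⟨h₁, h₂⟩ := htile_sub k hk ω hω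
      constructor <;> linarith
    · simp only [Finset.mem_Icc]
      omega
    · rw [mul_assoc, ← hη, abs_le]
      simp only [Int.cast_natCast, ← hδ]
      constructor <;> linarith [hω.1, hω.2]
  set Q : Set (ℝ × ℝ) := Icc 0 ((2 * η)⁻¹) ×ˢ Icc 0 (R / 4) with hQdef
  have hQ : MeasurableSet Q := measurableSet_Icc.prod measurableSet_Icc
  have hηinv : 0 < (2 * η)⁻¹ := by positivity
  have hQvol : volume.real Q = (2 * η)⁻¹ * (R / 4) := by
    rw [hQdef, Measure.volume_eq_prod, measureReal_prod_prod, Real.volume_real_Icc,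
      Real.volume_real_Icc, sub_zero, sub_zero, max_eq_left hηinv.le,
      max_eq_left (by positivity)]
  have hQfin : volume Q ≠ ∞ := (isCompact_Icc.prod isCompact_Icc).measure_ne_top
  have hA : (2 * η)⁻¹ < R := by
    rw [inv_lt_iff_one_lt_mul₀ (by positivity)]
    have : R * (2 * η) * (N * δ) = 2 := by linear_combination 2 * hδsq + 2 * R * δ * hηN
    nlinarith [mul_pos hR₀ hη₀]
  have hQB : ∀ s ∈ Q, ∀ s' ∈ Q, s - s' ∈ Metric.ball (0 : ℝ × ℝ) R := by
    rintro s ⟨hs₁, hs₂⟩ s' ⟨hs₁', hs₂'⟩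
    rw [mem_ball_zero_iff, Prod.norm_def, max_lt_iff, Real.norm_eq_abs, Real.norm_eq_abs, abs_lt,
      abs_lt, Prod.fst_sub, Prod.snd_sub]
    simp only [mem_Icc] at hs₁ hs₂ hs₁' hs₂'
    refine ⟨⟨?_, ?_⟩, ?_, ?_⟩ <;> linarith
  have hphase : ∀ p ∈ ⋃ k ∈ Finset.range N, tile δ η k ×ˢ tile δ η k, ∀ z ∈ Q,
      |(p.1 ^ 2 * z.2 + p.1 * z.1) - (p.2 ^ 2 * z.2 + p.2 * z.1)| ≤ 1 := by
    intro p hp z ⟨hz₁, hz₂⟩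
    simp only [mem_iUnion, Finset.mem_range] at hp
    obtain ⟨k, hk, hp₁, hp₂⟩ := hp
    have hb₁ := htile_sub k hk _ hp₁
    have hb₂ := htile_sub k hk _ hp₂
    have hdiff : |p.1 - p.2| ≤ η := by
      rw [abs_le]
      constructor <;> linarith [hp₁.1, hp₁.2, hp₂.1, hp₂.2]
    have hsum : |p.1 + p.2| ≤ 2 * (N * δ) := by
      rw [abs_le]
      constructor <;> linarith
    have hz₁' : |z.1| ≤ (2 * η)⁻¹ := by rw [abs_of_nonneg hz₁.1]; exact hz₁.2
    have hz₂' : |z.2| ≤ R / 4 := by rw [abs_of_nonneg hz₂.1]; exact hz₂.2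
    calc |(p.1 ^ 2 * z.2 + p.1 * z.1) - (p.2 ^ 2 * z.2 + p.2 * z.1)|
        = |(p.1 - p.2) * ((p.1 + p.2) * z.2 + z.1)| := by congr 1; ring
      _ ≤ |p.1 - p.2| * (|p.1 + p.2| * |z.2| + |z.1|) := by
          rw [abs_mul, ← abs_mul (p.1 + p.2)]
          exact mul_le_mul_of_nonneg_left (abs_add_le _ _) (abs_nonneg _)
      _ ≤ η * (2 * (N * δ) * (R / 4) + (2 * η)⁻¹) := by gcongr
      _ = 1 := by
          have : η * (2 * η)⁻¹ = 1 / 2 := by field_simp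
          linear_combination this + δ * R / 2 * hηN + hδsq / 2
  rw [extOp_bundleFn hcont hpos]
  have hmass := le_prod_biUnion_tile hη₀.le hηδ hμtile
  have hJ := le_integral_norm_sq_parabolaExt_sub μ hQ hQfin
    (Finset.measurableSet_biUnion _ fun k _ => (measurableSet_tile δ η k).prod (measurableSet_tile δ η k)) hphase
  have hfinal := le_lintegral_norm_pow_four (continuous_parabolaExt μ) (norm_parabolaExt_le μ)
    Metric.isOpen_ball.measurableSet hQ hQfin (by rw [hQvol]; positivity) hQB
    (a := N * η ^ 2 / 4) (by positivity)
    (le_trans (by nlinarith [mul_le_mul_of_nonneg_left hmass (sq_nonneg (volume.real Q))]) hJ)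
  refine le_trans (le_of_eq ?_) hfinal
  congr 1
  rw [hQvol, mul_assoc, ← hη]
  have h₁ : R * (η * N) ^ 2 = 1 := by rw [hηN]; linarith
  field_simp
  linear_combination (-128 : ℝ) * h₁

end
end
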